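/- arXiv:math/9804108 — 7 statements merged into one kernel-verified Lean document; each statement's English description precedes it below -/
import Mathlib

section
/- Let N be a locally compact Hausdorff topological space. Then for every integer l ≥ 1, the intersection of the closure of Γ_{s_l} (taken in N × ℝ^r × ℝ^l) with N × ℝ^r × {0} equals C(s) × {0}. In particular, this intersection is independent of l. -/
open Set Metric Topology

noncomputable section

/-- The graph `Γ_{t·s} = {(x, t • s x)}` of the rescaled section `t • s`. -/
def graphT {N : Type*} [TopologicalSpace N] {r : ℕ}
    (s : N → EuclideanSpace ℝ (Fin r)) (t : ℝ) :
    Set (N × EuclideanSpace ℝ (Fin r)) :=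
  {p | p.2 = t • s p.1}

/-- The cone `C(s) = ⋂_{t₀ > 0} closure (⋃_{t ≥ t₀} Γ_{t·s})` associated to `s`. -/
def coneOf {N : Type*} [TopologicalSpace N] {r : ℕ}
    (s : N → EuclideanSpace ℝ (Fin r)) :
    Set (N × EuclideanSpace ℝ (Fin r)) :=
  ⋂ t₀ ∈ Ioi (0 : ℝ), closure (⋃ t ∈ Ici t₀, graphT s t)

/-- The graph `Γ_{s_l} = {(x, ‖v‖⁻¹ • s x, v) : v ≠ 0} ⊆ N × ℝ^r × ℝ^l`. -/
def graphSl {N : Type*} [TopologicalSpace N] {r : ℕ}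
    (s : N → EuclideanSpace ℝ (Fin r)) (l : ℕ) :
    Set (N × EuclideanSpace ℝ (Fin r) × EuclideanSpace ℝ (Fin l)) :=
  {p | p.2.2 ≠ 0 ∧ p.2.1 = ‖p.2.2‖⁻¹ • s p.1}

theorem mem_coneOf_of_mem_closure_graphSl {N : Type*} [TopologicalSpace N] {r l : ℕ}
    {s : N → EuclideanSpace ℝ (Fin r)} {x : N} {w : EuclideanSpace ℝ (Fin r)}
    (h : (x, w, (0 : EuclideanSpace ℝ (Fin l))) ∈ closure (graphSl s l)) :
    (x, w) ∈ coneOf s := by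
  refine mem_iInter₂.2 fun t₀ (ht₀ : 0 < t₀) => mem_closure_iff.2 fun U hU hxw => ?_
  have hV : IsOpen {p : N × EuclideanSpace ℝ (Fin r) × EuclideanSpace ℝ (Fin l) |
      (p.1, p.2.1) ∈ U ∧ ‖p.2.2‖ < t₀⁻¹} :=
    (hU.preimage (continuous_fst.prodMk (continuous_fst.comp continuous_snd))).inter
      (isOpen_lt (continuous_snd.comp continuous_snd).norm continuous_const)
  obtain ⟨⟨y, z, v⟩, ⟨hyz, hv⟩, hv₀, hz⟩ :=
    mem_closure_iff.1 h _ hV ⟨hxw, by simpa using ht₀⟩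
  exact ⟨(y, z), hyz, mem_iUnion₂.2
    ⟨‖v‖⁻¹, (le_inv_comm₀ (norm_pos_iff.2 hv₀) ht₀).1 hv.le, hz⟩⟩

theorem mem_closure_graphSl_of_mem_coneOf {N : Type*} [TopologicalSpace N] {r l : ℕ}
    (hl : 1 ≤ l) {s : N → EuclideanSpace ℝ (Fin r)} {x : N} {w : EuclideanSpace ℝ (Fin r)}
    (h : (x, w) ∈ coneOf s) :
    (x, w, (0 : EuclideanSpace ℝ (Fin l))) ∈ closure (graphSl s l) := by
  refine mem_closure_iff_nhds.2 fun U hU => ?_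
  have hcont : Continuous fun q : (N × EuclideanSpace ℝ (Fin r)) × EuclideanSpace ℝ (Fin l) =>
      (q.1.1, q.1.2, q.2) := by fun_prop
  have hU' := hcont.continuousAt (x := ((x, w), 0)) hU
  obtain ⟨V, hV, W, hW, hVW⟩ := mem_nhds_prod_iff.1 (Filter.mem_map.1 hU')
  obtain ⟨ε, hε, hball⟩ := Metric.mem_nhds_iff.1 hW
  have ht₀ : 0 < 2 / ε := by positivity
  obtain ⟨⟨y, z⟩, hyz, hmem⟩ := mem_closure_iff_nhds.1 (mem_iInter₂.1 h (2 / ε) ht₀) V hV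
  obtain ⟨t, ht : 2 / ε ≤ t, hz : z = t • s y⟩ := mem_iUnion₂.1 hmem
  have ht_pos : 0 < t := ht₀.trans_le ht
  have : Nonempty (Fin l) := ⟨⟨0, hl⟩⟩
  obtain ⟨v, hnorm⟩ := exists_norm_eq (EuclideanSpace ℝ (Fin l)) (inv_pos.2 ht_pos).le
  refine ⟨(y, z, v), hVW (mk_mem_prod hyz (hball ?_)), ?_, ?_⟩
  · rw [mem_ball_zero_iff, hnorm]
    refine (inv_anti₀ ht₀ ht).trans_lt ?_
    rw [inv_div]
    exact half_lt_self hε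
  · exact norm_pos_iff.1 (hnorm.symm ▸ inv_pos.2 ht_pos)
  · simp only [hnorm, inv_inv, hz]

/-- The intersection of the closure of `Γ_{s_l}` with `N × ℝ^r × {0}` equals
`C(s) × {0}`; in particular it is independent of `l ≥ 1`. -/
theorem closure_graphSl_inter_zero_eq_cone
    {N : Type*} [TopologicalSpace N] [T2Space N] [LocallyCompactSpace N]
    {r : ℕ} (hr : 1 ≤ r)
    (s : N → EuclideanSpace ℝ (Fin r)) (hs : Continuous s)
    (l : ℕ) (hl : 1 ≤ l) :
    closure (graphSl s l) ∩
        {p : N × EuclideanSpace ℝ (Fin r) × EuclideanSpace ℝ (Fin l) | p.2.2 = 0} =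
      {p : N × EuclideanSpace ℝ (Fin r) × EuclideanSpace ℝ (Fin l) |
        (p.1, p.2.1) ∈ coneOf s ∧ p.2.2 = 0} := by
  ext ⟨x, w, v⟩
  refine and_congr_left fun hv => ?_
  obtain rfl : v = 0 := hv
  exact ⟨mem_coneOf_of_mem_closure_graphSl, mem_closure_graphSl_of_mem_coneOf hl⟩
end
end

section
/- Let N be a locally compact Hausdorff topological space. Then for every integer l ≥ 1 and every real t₀ > 0, one has closure(⋃_{t ≥ t₀} Γ_{t·s}) = P_l( closure(Γ_{s_l}) ∩ (N × ℝ^r × closedBall(0, 1/t₀)) ), where the first closure is taken in N × ℝ^r and the second in N × ℝ^r × ℝ^l. -/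
open Set Metric Topology

noncomputable section

/-- Projecting away a coordinate that ranges over a compact set preserves closedness. -/
theorem isClosed_image_proj_inter_of_isCompact {X Y Z : Type*} [TopologicalSpace X]
    [TopologicalSpace Y] [TopologicalSpace Z] {A : Set (X × Y × Z)} (hA : IsClosed A)
    {K : Set Z} (hK : IsCompact K) :
    IsClosed ((fun p : X × Y × Z => (p.1, p.2.1)) '' (A ∩ {p | p.2.2 ∈ K})) := by
  have : CompactSpace K := isCompact_iff_compactSpace.1 hK
  have hcont : Continuous (fun q : (X × Y) × K => (q.1.1, q.1.2, (q.2 : Z))) := by fun_prop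
  convert isClosedMap_fst_of_compactSpace _ (hA.preimage hcont) using 1
  ext ⟨x, y⟩
  constructor
  · rintro ⟨⟨a, b, z⟩, ⟨ha, hz⟩, h⟩
    exact ⟨((a, b), ⟨z, hz⟩), ha, h⟩
  · rintro ⟨⟨⟨a, b⟩, z⟩, ha, h⟩
    exact ⟨(a, b, z), ⟨ha, z.2⟩, h⟩

/-- Away from `v = 0`, the closure of `Γ_{s_l}` adds no new points. -/
theorem eq_of_mem_closure_graphSl {N : Type*} [TopologicalSpace N] {r l : ℕ}
    {s : N → EuclideanSpace ℝ (Fin r)} (hs : Continuous s)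
    {p : N × EuclideanSpace ℝ (Fin r) × EuclideanSpace ℝ (Fin l)}
    (hp : p ∈ closure (graphSl s l)) (hv : p.2.2 ≠ 0) :
    p.2.1 = ‖p.2.2‖⁻¹ • s p.1 := by
  have hclosed : IsClosed {q : N × EuclideanSpace ℝ (Fin r) × EuclideanSpace ℝ (Fin l) |
      ‖q.2.2‖ • q.2.1 = s q.1} := isClosed_eq (by fun_prop) (by fun_prop)
  have hsub : graphSl s l ⊆ {q | ‖q.2.2‖ • q.2.1 = s q.1} := fun q hq => by
    rw [mem_ofPred_eq, hq.2, smul_inv_smul₀ (norm_ne_zero_iff.2 hq.1)]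
  have h : ‖p.2.2‖ • p.2.1 = s p.1 := closure_minimal hsub hclosed hp
  rw [← h, inv_smul_smul₀ (norm_ne_zero_iff.2 hv)]

/-- `closure (⋃_{t ≥ t₀} Γ_{t·s})` is the image under the projection
`P_l : N × ℝ^r × ℝ^l → N × ℝ^r` of the part of `closure Γ_{s_l}` lying over the
closed ball of radius `1/t₀` in `ℝ^l`. -/
theorem closure_union_graphT_eq_proj_closure_graphSl
    {N : Type*} [TopologicalSpace N] [T2Space N] [LocallyCompactSpace N]
    {r : ℕ} (hr : 1 ≤ r)
    (s : N → EuclideanSpace ℝ (Fin r)) (hs : Continuous s)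
    (l : ℕ) (hl : 1 ≤ l) (t₀ : ℝ) (ht₀ : 0 < t₀) :
    closure (⋃ t ∈ Ici t₀, graphT s t) =
      (fun p : N × EuclideanSpace ℝ (Fin r) × EuclideanSpace ℝ (Fin l) =>
          (p.1, p.2.1)) ''
        (closure (graphSl s l) ∩
          {p : N × EuclideanSpace ℝ (Fin r) × EuclideanSpace ℝ (Fin l) |
            p.2.2 ∈ closedBall (0 : EuclideanSpace ℝ (Fin l)) (1 / t₀)}) := by
  apply Subset.antisymm
  · refine closure_minimal ?_ ?_
    · intro p hp
      simp only [mem_iUnion, mem_Ici, graphT, mem_ofPred_eq] at hp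
      obtain ⟨t, ht, hp⟩ := hp
      have htpos : 0 < t := ht₀.trans_le ht
      have hnorm : ‖EuclideanSpace.single (⟨0, hl⟩ : Fin l) t⁻¹‖ = t⁻¹ := by
        rw [PiLp.norm_single, Real.norm_of_nonneg (inv_pos.2 htpos).le]
      refine ⟨(p.1, p.2, EuclideanSpace.single ⟨0, hl⟩ t⁻¹), ⟨subset_closure ⟨?_, ?_⟩, ?_⟩, rfl⟩
      · exact norm_pos_iff.1 (hnorm.symm ▸ inv_pos.2 htpos)
      · simp only [hnorm, inv_inv, hp]
      · simp only [mem_ofPred_eq, mem_closedBall_zero_iff, hnorm, one_div]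
        exact inv_anti₀ ht₀ ht
    · exact isClosed_image_proj_inter_of_isCompact isClosed_closure
        (isCompact_closedBall (0 : EuclideanSpace ℝ (Fin l)) (1 / t₀))
  · rintro _ ⟨⟨x, w, v⟩, ⟨hcl, hv⟩, rfl⟩
    simp only [mem_ofPred_eq, mem_closedBall_zero_iff] at hv
    by_cases hv0 : v = 0
    · have hsmall : {p : N × EuclideanSpace ℝ (Fin r) × EuclideanSpace ℝ (Fin l) |
          ‖p.2.2‖ < 1 / t₀} ∈ 𝓝 (x, w, v) :=
        (isOpen_lt (by fun_prop) continuous_const).mem_nhds (by simpa [hv0] using ht₀)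
      rw [mem_closure_iff_nhds] at hcl ⊢
      intro U hU
      have hpre := (show Continuous
        (fun p : N × EuclideanSpace ℝ (Fin r) × EuclideanSpace ℝ (Fin l) => (p.1, p.2.1)) by
          fun_prop).continuousAt.preimage_mem_nhds (x := (x, w, v)) hU
      obtain ⟨⟨x', w', v'⟩, ⟨hU', hsmall'⟩, hv', hw'⟩ := hcl _ (Filter.inter_mem hpre hsmall)
      refine ⟨(x', w'), hU', mem_biUnion (x := ‖v'‖⁻¹) ?_ hw'⟩
      rw [mem_Ici, le_inv_comm₀ ht₀ (norm_pos_iff.2 hv'), ← one_div]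
      exact le_of_lt hsmall'
    · refine subset_closure (mem_biUnion (x := ‖v‖⁻¹) ?_ (eq_of_mem_closure_graphSl hs hcl hv0))
      rw [mem_Ici, le_inv_comm₀ ht₀ (norm_pos_iff.2 hv0), ← one_div]
      exact hv
end
end

section
/- Let N be a locally compact Hausdorff topological space. Then the graphs Γ_{t·s} converge to C(s) uniformly on compact sets as t → ∞, in the following sense: for every compact set K ⊆ N × ℝ^r and every open set U ⊆ N × ℝ^r with C(s) ⊆ U, there exists t₀ > 0 such that Γ_{t·s} ∩ K ⊆ U for all t ≥ t₀. -/
open Set Metric Topology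

noncomputable section

/-- The graphs `Γ_{t·s}` converge to `C(s)` uniformly on compact sets as
`t → ∞`: for every compact `K` and open `U ⊇ C(s)` there is `t₀ > 0` with
`Γ_{t·s} ∩ K ⊆ U` for all `t ≥ t₀`. -/
theorem graphT_tendsto_cone_on_compacts
    {N : Type*} [TopologicalSpace N] [T2Space N] [LocallyCompactSpace N]
    {r : ℕ} (hr : 1 ≤ r)
    (s : N → EuclideanSpace ℝ (Fin r)) (hs : Continuous s)
    (K : Set (N × EuclideanSpace ℝ (Fin r))) (hK : IsCompact K)
    (U : Set (N × EuclideanSpace ℝ (Fin r))) (hU : IsOpen U)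
    (hCU : coneOf s ⊆ U) :
    ∃ t₀ > (0 : ℝ), ∀ t ≥ t₀, graphT s t ∩ K ⊆ U := by
  let F : Ioi (0 : ℝ) → Set (N × EuclideanSpace ℝ (Fin r)) :=
    fun t₀ => closure (⋃ t ∈ Ici t₀.1, graphT s t)
  have hF : Antitone F := fun a b hab =>
    closure_mono (biUnion_subset_biUnion_left (Ici_subset_Ici.2 hab))
  have : Nonempty (Ioi (0 : ℝ)) := ⟨⟨1, mem_Ioi.2 one_pos⟩⟩
  have hempty : (K \ U) ∩ ⋂ i, F i = ∅ := by
    refine eq_empty_of_forall_notMem fun p hp => hp.1.2 (hCU ?_)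
    exact mem_iInter₂.2 fun t₀ ht₀ => mem_iInter.1 hp.2 ⟨t₀, ht₀⟩
  obtain ⟨⟨t₀, ht₀⟩, h⟩ := (hK.diff hU).elim_directed_family_closed F
    (fun _ => isClosed_closure) hempty hF.directed_ge
  refine ⟨t₀, ht₀, fun t ht p hp => ?_⟩
  by_contra hpU
  exact notMem_empty p (h ▸ ⟨⟨hp.2, hpU⟩, subset_closure (mem_biUnion ht hp.1)⟩)
end
end

section
/- Let N be a locally compact Hausdorff topological space. Then the image of C(s) under the projection N × ℝ^r → N, (x, f) ↦ x, equals the zero locus Z(s) of s. -/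
open Set Metric Topology

noncomputable section

/-- Points of the cone `C(s)` satisfy `t * ‖s x‖ ≤ ‖f‖` for every `t > 0`. -/
lemma mul_norm_le_norm_of_mem_coneOf {N : Type*} [TopologicalSpace N] {r : ℕ}
    {s : N → EuclideanSpace ℝ (Fin r)} (hs : Continuous s)
    {p : N × EuclideanSpace ℝ (Fin r)} (hp : p ∈ coneOf s) {t : ℝ} (ht : 0 < t) :
    t * ‖s p.1‖ ≤ ‖p.2‖ := by
  have hclosed : IsClosed {q : N × EuclideanSpace ℝ (Fin r) | t * ‖s q.1‖ ≤ ‖q.2‖} :=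
    isClosed_le (by fun_prop) (by fun_prop)
  refine closure_minimal ?_ hclosed (mem_iInter₂.mp hp t ht)
  refine iUnion₂_subset fun u hu q hq ↦ ?_
  have hu : t ≤ u := hu
  have hq : q.2 = u • s q.1 := hq
  rw [mem_ofPred_eq, hq, norm_smul, Real.norm_of_nonneg (ht.le.trans hu)]
  gcongr

/-- The projection of the cone `C(s)` to `N` is the zero locus `Z(s)` of `s`. -/
theorem proj_cone_eq_zero_locus
    {N : Type*} [TopologicalSpace N] [T2Space N] [LocallyCompactSpace N]
    {r : ℕ} (hr : 1 ≤ r)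
    (s : N → EuclideanSpace ℝ (Fin r)) (hs : Continuous s) :
    Prod.fst '' coneOf s = {x : N | s x = 0} := by
  ext x
  constructor
  · rintro ⟨p, hp, rfl⟩
    by_contra hne
    have hpos : 0 < ‖s p.1‖ := norm_pos_iff.mpr hne
    have hle := mul_norm_le_norm_of_mem_coneOf hs hp (t := (‖p.2‖ + 1) / ‖s p.1‖) (by positivity)
    rw [div_mul_cancel₀ _ hpos.ne'] at hle
    linarith
  · intro hx
    have hx : s x = 0 := hx
    refine ⟨(x, 0), mem_iInter₂.mpr fun t _ ↦ subset_closure ?_, rfl⟩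
    exact mem_iUnion₂.mpr ⟨t, self_mem_Ici, by simp [graphT, hx]⟩
end
end

section
/- Let N be any topological space and let K ⊆ N × ℝ^r be a compact set such that s x ≠ 0 for every x in the image of K under the projection N × ℝ^r → N. Then there exists t₀ > 0 such that Γ_{t·s} ∩ K = ∅ for all t ≥ t₀. In particular, no point of K lying over a point where s does not vanish belongs to C(s). -/
open Set Metric Topology

noncomputable section

/-- The region `‖y‖ < t₀ * ‖s x‖` is disjoint from the graphs of `t • s` with `t ≥ t₀`. -/
theorem notMem_graphT_of_norm_lt {N : Type*} [TopologicalSpace N] {r : ℕ}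
    {s : N → EuclideanSpace ℝ (Fin r)} {t₀ t : ℝ} (ht : t₀ ≤ t)
    {p : N × EuclideanSpace ℝ (Fin r)} (hp : ‖p.2‖ < t₀ * ‖s p.1‖) : p ∉ graphT s t := by
  intro (h : p.2 = t • s p.1)
  rw [h, norm_smul, Real.norm_eq_abs] at hp
  exact hp.not_ge (by gcongr; exact ht.trans (le_abs_self t))

/-- The cone `C(s)` is disjoint from each open region `‖y‖ < t₀ * ‖s x‖`. -/
theorem notMem_coneOf_of_norm_lt {N : Type*} [TopologicalSpace N] {r : ℕ}
    {s : N → EuclideanSpace ℝ (Fin r)} (hs : Continuous s) {t₀ : ℝ} (ht₀ : 0 < t₀)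
    {p : N × EuclideanSpace ℝ (Fin r)} (hp : ‖p.2‖ < t₀ * ‖s p.1‖) : p ∉ coneOf s := by
  intro hpC
  have hU : IsOpen {q : N × EuclideanSpace ℝ (Fin r) | ‖q.2‖ < t₀ * ‖s q.1‖} :=
    isOpen_lt (by fun_prop) (by fun_prop)
  obtain ⟨q, hqU, hq⟩ := mem_closure_iff.1 (mem_iInter₂.1 hpC t₀ ht₀) _ hU hp
  obtain ⟨t, ht, hqt⟩ := mem_iUnion₂.1 hq
  exact notMem_graphT_of_norm_lt ht hqU hqt

/-- A compact set over which `s` has no zero lies in some region `‖y‖ < t₀ * ‖s x‖`. -/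
theorem exists_norm_lt_of_isCompact {N : Type*} [TopologicalSpace N] {r : ℕ}
    {s : N → EuclideanSpace ℝ (Fin r)} (hs : Continuous s)
    {K : Set (N × EuclideanSpace ℝ (Fin r))} (hK : IsCompact K) (hKs : ∀ p ∈ K, s p.1 ≠ 0) :
    ∃ t₀ > (0 : ℝ), ∀ p ∈ K, ‖p.2‖ < t₀ * ‖s p.1‖ := by
  have hf : ContinuousOn (fun p : N × EuclideanSpace ℝ (Fin r) => ‖p.2‖ / ‖s p.1‖) K :=
    ContinuousOn.div (by fun_prop) (by fun_prop) fun p hp => norm_ne_zero_iff.2 (hKs p hp)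
  obtain ⟨M, hM⟩ := hK.bddAbove_image hf
  refine ⟨max M 0 + 1, by positivity, fun p hp => ?_⟩
  rw [← div_lt_iff₀ (norm_pos_iff.2 (hKs p hp))]
  exact (hM (mem_image_of_mem _ hp)).trans_lt ((le_max_left M 0).trans_lt (lt_add_one _))

/-- If `K` is compact and `s` has no zero over the projection of `K`, then the
graphs `Γ_{t·s}` eventually miss `K`; in particular no point of `K` belongs to
the cone `C(s)`. -/
theorem graphT_eventually_misses_compact
    {N : Type*} [TopologicalSpace N] {r : ℕ} (hr : 1 ≤ r)
    (s : N → EuclideanSpace ℝ (Fin r)) (hs : Continuous s)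
    (K : Set (N × EuclideanSpace ℝ (Fin r))) (hK : IsCompact K)
    (hKs : ∀ p ∈ K, s p.1 ≠ 0) :
    (∃ t₀ > (0 : ℝ), ∀ t ≥ t₀, graphT s t ∩ K = ∅) ∧
      ∀ p ∈ K, p ∉ coneOf s := by
  obtain ⟨t₀, ht₀, hlt⟩ := exists_norm_lt_of_isCompact hs hK hKs
  refine ⟨⟨t₀, ht₀, fun t ht => ?_⟩, fun p hp => notMem_coneOf_of_norm_lt hs ht₀ (hlt p hp)⟩
  exact eq_empty_of_forall_notMem fun p hp => notMem_graphT_of_norm_lt ht (hlt p hp.2) hp.1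
end
end

section
/- (The Cauchy transform is a right inverse to ∂̄.) Let γ : ℂ → ℂ be continuously ℝ-differentiable with compact support, and define u : ℂ → ℂ by u(z) := −(1/π) ∫_ℂ γ(w)/(w − z) dA(w). Then u is ℝ-differentiable at every point z ∈ ℂ and ∂̄u(z) = γ(z) for all z ∈ ℂ. -/
open Set MeasureTheory Real

noncomputable section

/-- The Wirtinger operator `∂̄g(w) = (1/2)(∂g/∂x(w) + i·∂g/∂y(w))`, where the
partial derivatives are the directional derivatives in the directions `1`
and `i`. -/
def dbar (g : ℂ → ℂ) (w : ℂ) : ℂ :=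
  (fderiv ℝ g w 1 + Complex.I * fderiv ℝ g w Complex.I) / 2

open scoped Convolution

theorem locallyIntegrable_inv_complex : LocallyIntegrable (fun z : ℂ => z⁻¹) := by
  refine locallyIntegrable_of_norm_le_rpow (C := 1) (α := 1) (by simp) (by simp) ?_ ?_
  · exact Filter.Eventually.of_forall fun z => by simp [Real.rpow_neg_one]
  · exact (measurable_inv (G := ℂ)).aestronglyMeasurable

/-- The point `e^{iθ}` of the unit circle, in the form produced by `Complex.polarCoord`. -/
def unitPoint (θ : ℝ) : ℂ := Real.cos θ + Real.sin θ * Complex.I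

theorem norm_unitPoint (θ : ℝ) : ‖unitPoint θ‖ = 1 := by
  rw [unitPoint, Complex.ofReal_cos, Complex.ofReal_sin, ← Complex.exp_mul_I]
  exact Complex.norm_exp_ofReal_mul_I θ

theorem unitPoint_ne_zero (θ : ℝ) : unitPoint θ ≠ 0 := by
  rw [← norm_ne_zero_iff, norm_unitPoint]
  exact one_ne_zero

@[fun_prop]
theorem continuous_unitPoint : Continuous unitPoint := by
  unfold unitPoint
  fun_prop

theorem hasDerivAt_unitPoint (θ : ℝ) :
    HasDerivAt unitPoint (Complex.I * unitPoint θ) θ := by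
  have hc := (Real.hasDerivAt_cos θ).ofReal_comp
  have hs := (Real.hasDerivAt_sin θ).ofReal_comp
  refine (hc.add (hs.mul_const Complex.I)).congr_deriv ?_
  simp only [unitPoint, Complex.ofReal_neg]
  linear_combination (-(Real.sin θ : ℂ)) * Complex.I_mul_I

theorem inv_unitPoint (θ : ℝ) :
    (unitPoint θ)⁻¹ = Real.cos θ - Real.sin θ * Complex.I := by
  refine inv_eq_of_mul_eq_one_right ?_
  have h : (Real.cos θ : ℂ) ^ 2 + (Real.sin θ : ℂ) ^ 2 = 1 := by
    exact_mod_cast Real.cos_sq_add_sin_sq θ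
  rw [unitPoint]
  linear_combination h - (Real.sin θ : ℂ) ^ 2 * Complex.I_mul_I

/-- The operator `∂̄` in polar coordinates. -/
theorem inv_unitPoint_mul_dbar (h : ℂ → ℂ) (w : ℂ) (θ : ℝ) :
    (unitPoint θ)⁻¹ * dbar h w =
      (fderiv ℝ h w (unitPoint θ) + Complex.I * fderiv ℝ h w (Complex.I * unitPoint θ)) / 2 := by
  have h1 : unitPoint θ = Real.cos θ • (1 : ℂ) + Real.sin θ • Complex.I := by
    simp [unitPoint]
  have h2 : Complex.I * unitPoint θ = Real.cos θ • Complex.I - Real.sin θ • (1 : ℂ) := by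
    simp only [unitPoint, Complex.real_smul]
    linear_combination (Real.sin θ : ℂ) * Complex.I_mul_I
  rw [h2, inv_unitPoint, h1, dbar]
  simp only [map_add, map_sub, map_smul]
  simp only [Complex.real_smul]
  linear_combination (-(Real.sin θ : ℂ) * fderiv ℝ h w Complex.I / 2) * Complex.I_mul_I

/-- A directional derivative along a bounded continuous field of directions, pulled back to polar
coordinates, is integrable. -/
theorem integrable_fderiv_polar {h : ℂ → ℂ} (hh : ContDiff ℝ 1 h) (hc : HasCompactSupport h)
    {v : ℝ → ℂ} (hv : Continuous v) :
    Integrable (fun p : ℝ × ℝ => fderiv ℝ h (p.1 * unitPoint p.2) (v p.2))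
      ((volume.restrict (Ioi 0)).prod (volume.restrict (Ioo (-π) π))) := by
  obtain ⟨R, hR⟩ := (hc.fderiv ℝ).isCompact.isBounded.subset_closedBall 0
  have hcont : Continuous (fun p : ℝ × ℝ => fderiv ℝ h (p.1 * unitPoint p.2) (v p.2)) := by
    have := hh.continuous_fderiv one_ne_zero
    fun_prop
  rw [Measure.prod_restrict]
  change IntegrableOn _ _ _
  have hK : IntegrableOn (fun p : ℝ × ℝ => fderiv ℝ h (p.1 * unitPoint p.2) (v p.2))
      (Icc 0 R ×ˢ Icc (-π) π) (volume.prod volume) :=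
    hcont.continuousOn.integrableOn_compact (isCompact_Icc.prod isCompact_Icc)
  refine hK.of_forall_sdiff_eq_zero (measurableSet_Ioi.prod measurableSet_Ioo) ?_
  rintro ⟨r, θ⟩ ⟨⟨hr, hθ⟩, hn⟩
  have hrR : R < r := by
    by_contra! hle
    exact hn ⟨⟨le_of_lt hr, hle⟩, Ioo_subset_Icc_self hθ⟩
  have hr0 : (0 : ℝ) < r := hr
  have : (r : ℂ) * unitPoint θ ∉ tsupport (fderiv ℝ h) := fun hmem => by
    have := hR hmem
    rw [mem_closedBall_zero_iff, norm_mul, norm_unitPoint, mul_one, Complex.norm_real,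
      Real.norm_of_nonneg hr0.le] at this
    linarith
  simp [image_eq_zero_of_notMem_tsupport this]

theorem integral_radial_fderiv {h : ℂ → ℂ} (hh : ContDiff ℝ 1 h) (hc : HasCompactSupport h)
    (θ : ℝ) :
    ∫ r in Ioi (0 : ℝ), fderiv ℝ h (r * unitPoint θ) (unitPoint θ) = -h 0 := by
  have hemb : Topology.IsClosedEmbedding (fun r : ℝ => (r : ℂ) * unitPoint θ) :=
    (Homeomorph.mulRight₀ _ (unitPoint_ne_zero θ)).isClosedEmbedding.comp
      Complex.isometry_ofReal.isClosedEmbedding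
  have hd : ∀ r : ℝ, HasDerivAt (fun r : ℝ => h (r * unitPoint θ))
      (fderiv ℝ h (r * unitPoint θ) (unitPoint θ)) r := fun r => by
    have h1 : HasDerivAt (fun r : ℝ => (r : ℂ) * unitPoint θ) (unitPoint θ) r := by
      simpa using (hasDerivAt_id r).ofReal_comp.mul_const (unitPoint θ)
    exact (hh.differentiable one_ne_zero _).hasFDerivAt.comp_hasDerivAt r h1
  have hcs : HasCompactSupport (fun r : ℝ => h (r * unitPoint θ)) :=
    hc.comp_isClosedEmbedding hemb
  have hderiv : deriv (fun r : ℝ => h (r * unitPoint θ)) =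
      fun r : ℝ => fderiv ℝ h (r * unitPoint θ) (unitPoint θ) :=
    funext fun r => (hd r).deriv
  have hcd : ContDiff ℝ 1 (fun r : ℝ => h (r * unitPoint θ)) :=
    hh.comp ((Complex.ofRealCLM.contDiff).mul contDiff_const)
  rw [← hderiv, hcs.integral_Ioi_deriv_eq hcd]
  simp

theorem integral_angular_fderiv {h : ℂ → ℂ} (hh : ContDiff ℝ 1 h) {r : ℝ} (hr : 0 < r) :
    ∫ θ in Ioo (-π) π, fderiv ℝ h (r * unitPoint θ) (Complex.I * unitPoint θ) = 0 := by
  have hd : ∀ θ : ℝ, HasDerivAt (fun θ : ℝ => h (r * unitPoint θ))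
      (r • fderiv ℝ h (r * unitPoint θ) (Complex.I * unitPoint θ)) θ := fun θ => by
    have h1 := (hasDerivAt_unitPoint θ).const_mul (r : ℂ)
    have h2 := (hh.differentiable one_ne_zero _).hasFDerivAt.comp_hasDerivAt θ h1
    rwa [← Complex.real_smul (x := r) (z := Complex.I * unitPoint θ), map_smul] at h2
  have hcont : Continuous
      (fun θ : ℝ => r • fderiv ℝ h (r * unitPoint θ) (Complex.I * unitPoint θ)) := by
    have := hh.continuous_fderiv one_ne_zero
    fun_prop
  have hint := intervalIntegral.integral_eq_sub_of_hasDerivAt (fun θ _ => hd θ)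
    (hcont.intervalIntegrable (-π) π)
  rw [intervalIntegral.integral_smul, intervalIntegral.integral_of_le (by linarith [Real.pi_pos]),
    integral_Ioc_eq_integral_Ioo] at hint
  have hend : unitPoint π = unitPoint (-π) := by simp [unitPoint]
  rw [hend, sub_self] at hint
  exact (smul_eq_zero.mp hint).resolve_left hr.ne'

/-- The Cauchy–Pompeiu formula for compactly supported functions, at the origin. -/
theorem integral_inv_mul_dbar {h : ℂ → ℂ} (hh : ContDiff ℝ 1 h) (hc : HasCompactSupport h) :
    ∫ w : ℂ, w⁻¹ * dbar h w = -(π : ℂ) * h 0 := by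
  have hA := integrable_fderiv_polar hh hc continuous_unitPoint
  have hB := integrable_fderiv_polar hh hc (v := fun θ => Complex.I * unitPoint θ) (by fun_prop)
  have hIA : ∫ p : ℝ × ℝ, fderiv ℝ h (p.1 * unitPoint p.2) (unitPoint p.2)
      ∂((volume.restrict (Ioi 0)).prod (volume.restrict (Ioo (-π) π))) = -(2 * π : ℂ) * h 0 := by
    rw [integral_prod_symm _ hA]
    simp only [integral_radial_fderiv hh hc, setIntegral_const]
    rw [Real.volume_real_Ioo_of_le (by linarith [Real.pi_pos]), Complex.real_smul]
    push_cast
    ring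
  have hIB : ∫ p : ℝ × ℝ, fderiv ℝ h (p.1 * unitPoint p.2) (Complex.I * unitPoint p.2)
      ∂((volume.restrict (Ioi 0)).prod (volume.restrict (Ioo (-π) π))) = 0 := by
    rw [integral_prod _ hB]
    exact setIntegral_eq_zero_of_forall_eq_zero fun r hr => integral_angular_fderiv hh hr
  have hpolar : ∀ p ∈ polarCoord.target,
      p.1 • ((Complex.polarCoord.symm p)⁻¹ * dbar h (Complex.polarCoord.symm p)) =
        (fderiv ℝ h (p.1 * unitPoint p.2) (unitPoint p.2) +
          Complex.I * fderiv ℝ h (p.1 * unitPoint p.2) (Complex.I * unitPoint p.2)) / 2 := by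
    rintro ⟨r, θ⟩ ⟨hr, -⟩
    have hr0 : (r : ℂ) ≠ 0 := Complex.ofReal_ne_zero.mpr (ne_of_gt hr)
    rw [Complex.polarCoord_symm_apply]
    change r • (((r : ℂ) * unitPoint θ)⁻¹ * dbar h (r * unitPoint θ)) = _
    rw [← inv_unitPoint_mul_dbar, Complex.real_smul, mul_inv, mul_assoc,
      mul_inv_cancel_left₀ hr0]
  rw [← Complex.integral_comp_polarCoord_symm,
    setIntegral_congr_fun polarCoord.open_target.measurableSet hpolar, polarCoord_target,
    Measure.volume_eq_prod, ← Measure.prod_restrict, integral_div,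
    integral_add hA (hB.const_mul _), integral_const_mul, hIA, hIB]
  ring

theorem dbar_comp_const_sub {γ : ℂ → ℂ} (hγ : Differentiable ℝ γ) (z t : ℂ) :
    dbar (fun t => γ (z - t)) t = -dbar γ (z - t) := by
  have h := (hγ (z - t)).hasFDerivAt.comp t ((hasFDerivAt_id (𝕜 := ℝ) t).const_sub z)
  have h' : fderiv ℝ (fun t => γ (z - t)) t = _ := h.fderiv
  rw [dbar, dbar, h']
  simp only [ContinuousLinearMap.comp_apply, neg_apply, ContinuousLinearMap.id_apply, map_neg]
  ring

theorem cauchyTransform_eq_convolution (γ : ℂ → ℂ) (z : ℂ) :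
    -(1 / (π : ℂ)) * ∫ w : ℂ, γ w / (w - z) =
      (1 / (π : ℂ)) *
        ((fun t : ℂ => t⁻¹) ⋆[ContinuousLinearMap.mul ℝ ℂ, volume] γ) z := by
  rw [convolution_def, ← integral_sub_left_eq_self (fun w => γ w / (w - z)) volume z,
    neg_mul, ← mul_neg, ← integral_neg]
  congr 2 with t
  rw [ContinuousLinearMap.mul_apply', sub_sub_cancel_left, div_neg, neg_neg, div_eq_inv_mul]

/-- The Cauchy transform is a right inverse to `∂̄`: if `γ` is `C¹` with compact
support and `u(z) = −(1/π) ∫ γ(w)/(w − z) dA(w)`, then `u` is `ℝ`-differentiable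
everywhere and `∂̄u = γ`. -/
theorem cauchy_transform_right_inverse_dbar
    (γ : ℂ → ℂ) (hγ : ContDiff ℝ 1 γ) (hsupp : HasCompactSupport γ) :
    ∀ z : ℂ,
      DifferentiableAt ℝ
        (fun z' : ℂ => -(1 / (π : ℂ)) * ∫ w : ℂ, γ w / (w - z')) z ∧
      dbar (fun z' : ℂ => -(1 / (π : ℂ)) * ∫ w : ℂ, γ w / (w - z')) z = γ z := by
  intro z
  simp only [cauchyTransform_eq_convolution]
  have hconv := (hsupp.hasFDerivAt_convolution_right (ContinuousLinearMap.mul ℝ ℂ)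
    locallyIntegrable_inv_complex hγ z).const_mul (1 / (π : ℂ))
  refine ⟨hconv.differentiableAt, ?_⟩
  have hint : ∀ v : ℂ, Integrable fun t : ℂ => t⁻¹ * fderiv ℝ γ (z - t) v := fun v =>
    (hsupp.fderiv_apply ℝ v).convolutionExists_right (ContinuousLinearMap.mul ℝ ℂ)
      locallyIntegrable_inv_complex
      ((hγ.continuous_fderiv one_ne_zero).clm_apply continuous_const) z
  have happ : ∀ v : ℂ, fderiv ℝ (fun z' => (1 / (π : ℂ)) *
      ((fun t : ℂ => t⁻¹) ⋆[ContinuousLinearMap.mul ℝ ℂ, volume] γ) z') z v =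
        (1 / (π : ℂ)) * ∫ t : ℂ, t⁻¹ * fderiv ℝ γ (z - t) v := fun v => by
    rw [hconv.fderiv, smul_apply, smul_eq_mul,
      convolution_precompR_apply _ locallyIntegrable_inv_complex (hsupp.fderiv ℝ)
        (hγ.continuous_fderiv one_ne_zero)]
    rfl
  have hpompeiu := integral_inv_mul_dbar (h := fun t => γ (z - t))
    (hγ.comp (contDiff_const.sub contDiff_id)) (hsupp.comp_homeomorph (Homeomorph.subLeft z))
  have hsplit : ∀ t : ℂ, t⁻¹ * dbar (fun t => γ (z - t)) t =
      -((t⁻¹ * fderiv ℝ γ (z - t) 1 +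
        Complex.I * (t⁻¹ * fderiv ℝ γ (z - t) Complex.I)) / 2) := fun t => by
    rw [dbar_comp_const_sub (hγ.differentiable one_ne_zero), dbar]
    ring
  simp only [hsplit] at hpompeiu
  rw [integral_neg, integral_div, integral_add (hint 1) ((hint Complex.I).const_mul _),
    integral_const_mul, sub_zero] at hpompeiu
  have hpi : (π : ℂ) ≠ 0 := Complex.ofReal_ne_zero.mpr Real.pi_ne_zero
  rw [dbar, happ, happ]
  refine mul_left_cancel₀ hpi ?_
  linear_combination (-1) * hpompeiu + ((∫ t : ℂ, t⁻¹ * fderiv ℝ γ (z - t) 1) +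
    Complex.I * ∫ t : ℂ, t⁻¹ * fderiv ℝ γ (z - t) Complex.I) / 2 * mul_inv_cancel₀ hpi
end
end

section
/- Let N be a locally compact Hausdorff topological space and suppose s x ≠ 0 for every x ∈ N (s has no zeros). Then C(s) = ∅. -/
open Set Metric Topology

noncomputable section

/-- Every point `(x, v)` of the closure of the graphs `Γ_{t·s}` with `t ≥ t₀ ≥ 0` satisfies
`t₀ * ‖s x‖ ≤ ‖v‖`. -/
theorem mul_norm_le_of_mem_closure_graphT {N : Type*} [TopologicalSpace N] {r : ℕ}
    {s : N → EuclideanSpace ℝ (Fin r)} (hs : Continuous s) {t₀ : ℝ} (ht₀ : 0 ≤ t₀)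
    {p : N × EuclideanSpace ℝ (Fin r)} (hp : p ∈ closure (⋃ t ∈ Ici t₀, graphT s t)) :
    t₀ * ‖s p.1‖ ≤ ‖p.2‖ := by
  have hclosed : IsClosed {q : N × EuclideanSpace ℝ (Fin r) | t₀ * ‖s q.1‖ ≤ ‖q.2‖} :=
    isClosed_le (by fun_prop) (by fun_prop)
  refine closure_minimal (fun q hq ↦ ?_) hclosed hp
  obtain ⟨t, ht, hqt⟩ := mem_iUnion₂.1 hq
  rw [mem_Ici] at ht
  have hq2 : q.2 = t • s q.1 := hqt
  rw [mem_ofPred_eq, hq2, norm_smul, Real.norm_of_nonneg (ht₀.trans ht)]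
  gcongr

/-- Over a locally compact Hausdorff base, if `s` has no zeros then the cone
`C(s)` is empty. -/
theorem cone_empty_of_no_zeros
    {N : Type*} [TopologicalSpace N] [T2Space N] [LocallyCompactSpace N]
    {r : ℕ} (hr : 1 ≤ r)
    (s : N → EuclideanSpace ℝ (Fin r)) (hs : Continuous s)
    (hzero : ∀ x : N, s x ≠ 0) :
    coneOf s = ∅ := by
  refine eq_empty_of_forall_notMem fun p hp ↦ ?_
  have hpos : 0 < ‖s p.1‖ := norm_pos_iff.2 (hzero p.1)
  have ht₀ : 0 < (‖p.2‖ + 1) / ‖s p.1‖ := by positivity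
  have hle := mul_norm_le_of_mem_closure_graphT hs ht₀.le (mem_iInter₂.1 hp _ ht₀)
  rw [div_mul_cancel₀ _ hpos.ne'] at hle
  linarith
end
end
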